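/- Let G be a finite group with an exact factorization by subgroups G1, G2, so that every g ∈ G is uniquely g = ab with a ∈ G1, b ∈ G2 (and also uniquely g = b'a' with b' ∈ G2, a' ∈ G1). For a ∈ G1 and b ∈ G2 let a ▹ b ∈ G2 denote the unique element with (a b) G1 = (a ▹ b) G1 (the action of G1 on G2 ≅ G/G1), and let b ▹ a ∈ G1 denote the unique element with (b a) G2 = (b ▹ a) G2 (the action of G2 on G1 ≅ G/G2). Then there exists a Hopf algebra structure over ℂ on the vector space H = (G2 → ℂ) ⊗ ℂ[G1] (the tensor product of the dual of the group algebra of G2, identified with complex-valued functions on G2 with pointwise multiplication, with the group algebra of G1) such that: (i) the multiplication satisfies (δ_b ⊗ a)·(δ_c ⊗ d) = (δ_b ⊗ a d) if b = a ▹ c and 0 otherwise, for all a, d ∈ G1 and b, c ∈ G2, where δ_b is the indicator function of b; (ii) the comultiplication satisfies Δ(δ_x ⊗ a) = Σ over pairs (b, c) ∈ G2 × G2 with b c = x of (δ_b ⊗ a) ⊗ (δ_c ⊗ (b⁻¹ ▹ a)), for all x ∈ G2 and a ∈ G1; and moreover (iii) H is a semisimple ring. -/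

import Mathlib

open scoped TensorProduct Classical

/-- A Hopf algebra structure (realized on an abstract type `A` identified, as a
complex vector space, with `(G2 → ℂ) ⊗ ℂ[G1]` via a linear equivalence `equiv`)
with the multiplication and comultiplication of the Kac–Takeuchi bicrossproduct
associated to an exact factorization `G = G1 G2`, and which is a semisimple ring.
Here `δ b = fun y => if y = b then 1 else 0` is the indicator function of `b`,
`actL a c` is the element `a ▹ c` of `G2` and `actR b a` is the element `b ▹ a`
of `G1`. -/
structure BicrossproductHopfStructure {G : Type} [Group G] [Fintype G]
    (G1 G2 : Subgroup G) (actL : G1 → G2 → G2) (actR : G2 → G1 → G1) where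
  /-- The underlying type of the Hopf algebra. -/
  A : Type
  [ring : Ring A]
  [hopf : HopfAlgebra ℂ A]
  /-- Identification of `A` with the vector space `(G2 → ℂ) ⊗ ℂ[G1]`. -/
  equiv : A ≃ₗ[ℂ] ((↥G2 → ℂ) ⊗[ℂ] MonoidAlgebra ℂ ↥G1)
  /-- (i): the multiplication satisfies
  `(δ_b ⊗ a) * (δ_c ⊗ d) = δ_b ⊗ (a d)` if `b = a ▹ c`, and `0` otherwise. -/
  mul_eq : ∀ (a d : ↥G1) (b c : ↥G2),
    equiv (equiv.symm ((fun y => if y = b then (1 : ℂ) else 0) ⊗ₜ[ℂ]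
             MonoidAlgebra.of ℂ ↥G1 a) *
           equiv.symm ((fun y => if y = c then (1 : ℂ) else 0) ⊗ₜ[ℂ]
             MonoidAlgebra.of ℂ ↥G1 d)) =
      if b = actL a c then
        (fun y => if y = b then (1 : ℂ) else 0) ⊗ₜ[ℂ] MonoidAlgebra.of ℂ ↥G1 (a * d)
      else 0
  /-- (ii): the comultiplication satisfies
  `Δ (δ_x ⊗ a) = ∑_{b c = x} (δ_b ⊗ a) ⊗ (δ_c ⊗ (b⁻¹ ▹ a))`. -/
  comul_eq : ∀ (x : ↥G2) (a : ↥G1),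
    (TensorProduct.map equiv.toLinearMap equiv.toLinearMap)
        (Coalgebra.comul (R := ℂ)
          (equiv.symm ((fun y => if y = x then (1 : ℂ) else 0) ⊗ₜ[ℂ]
            MonoidAlgebra.of ℂ ↥G1 a))) =
      ∑ b : ↥G2, ∑ c : ↥G2,
        if b * c = x then
          ((fun y => if y = b then (1 : ℂ) else 0) ⊗ₜ[ℂ] MonoidAlgebra.of ℂ ↥G1 a) ⊗ₜ[ℂ]
          ((fun y => if y = c then (1 : ℂ) else 0) ⊗ₜ[ℂ]
            MonoidAlgebra.of ℂ ↥G1 (actR b⁻¹ a))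
        else 0
  /-- (iii): `H` is a semisimple ring. -/
  semisimple : IsSemisimpleRing A

/-- A matched pair of groups: a left action of `X` on the set `Y` and a left action of `Y` on the
set `X`, compatible as the actions coming from an exact factorization of a group are. -/
structure MatchedPair (X Y : Type*) [Group X] [Group Y] where
  /-- The action of `X` on `Y`. -/
  l : X → Y → Y
  /-- The action of `Y` on `X`. -/
  r : Y → X → X
  one_l : ∀ b, l 1 b = b
  mul_l : ∀ a d b, l (a * d) b = l a (l d b)
  one_r : ∀ a, r 1 a = a
  mul_r : ∀ b c a, r (b * c) a = r b (r c a)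
  l_mul : ∀ a b c, l a (b * c) = l a b * l (r (l a b)⁻¹ a) c
  r_mul : ∀ a d b, r (l a b)⁻¹ (a * d) = r (l a b)⁻¹ a * r b⁻¹ d

namespace MatchedPair

variable {X Y : Type*} [Group X] [Group Y] (M : MatchedPair X Y)

lemma l_inv_l (a : X) (b : Y) : M.l a⁻¹ (M.l a b) = b := by
  rw [← M.mul_l, inv_mul_cancel, M.one_l]

lemma l_l_inv (a : X) (b : Y) : M.l a (M.l a⁻¹ b) = b := by
  rw [← M.mul_l, mul_inv_cancel, M.one_l]

lemma l_injective (a : X) : Function.Injective (M.l a) :=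
  Function.LeftInverse.injective (M.l_inv_l a)

/-- The action of an element of `X` as a permutation of `Y`. -/
@[simps]
def lEquiv (a : X) : Y ≃ Y := ⟨M.l a, M.l a⁻¹, M.l_inv_l a, M.l_l_inv a⟩

lemma l_one (a : X) : M.l a 1 = 1 := by
  have h := M.l_mul a (M.l a⁻¹ 1) 1
  rw [M.l_l_inv, inv_one, M.one_r, one_mul, mul_one, M.l_l_inv] at h
  exact h.symm

lemma r_one (b : Y) : M.r b 1 = 1 := by
  have h := M.r_mul 1 1 b⁻¹
  rw [M.one_l, inv_inv, mul_one] at h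
  exact left_eq_mul.mp h

lemma l_r_inv (a : X) (c : Y) : M.l (M.r (M.l a c)⁻¹ a) c⁻¹ = (M.l a c)⁻¹ := by
  have h := M.l_mul a c c⁻¹
  rw [mul_inv_cancel, M.l_one] at h
  exact (inv_eq_of_mul_eq_one_right h.symm).symm

lemma eq_l_inv_iff (a : X) (c x : Y) :
    c⁻¹ = M.l (M.r (M.l a c)⁻¹ a)⁻¹ ((M.l a c)⁻¹ * x) ↔ x = 1 := by
  rw [← (M.l_injective (M.r (M.l a c)⁻¹ a)).eq_iff, M.l_l_inv, M.l_r_inv, left_eq_mul]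

variable (k : Type*) [Field k]

/-- The underlying vector space of the bicrossproduct of `k^Y` and `k[X]`, with basis `Y × X`. -/
def Bicross (_ : MatchedPair X Y) (k : Type*) [Field k] : Type _ := Y × X →₀ k

namespace Bicross

noncomputable instance : AddCommGroup (M.Bicross k) := inferInstanceAs (AddCommGroup (_ →₀ k))

noncomputable instance : Module k (M.Bicross k) := inferInstanceAs (Module k (_ →₀ k))

/-- The basis of elements `δ_b ⊗ a`. -/
noncomputable def basis : Module.Basis (Y × X) k (M.Bicross k) := ⟨LinearEquiv.refl k _⟩

/-- The basis element `δ_b ⊗ a`. -/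
noncomputable def t (b : Y) (a : X) : M.Bicross k := basis M k (b, a)

variable {M k}

@[elab_as_elim]
lemma induction {p : M.Bicross k → Prop} (x : M.Bicross k) (ht : ∀ b a, p (t M k b a))
    (hadd : ∀ x y, p x → p y → p (x + y)) (hsmul : ∀ (c : k) x, p x → p (c • x)) : p x := by
  have hx : x ∈ Submodule.span k (Set.range (basis M k)) := by
    rw [(basis M k).span_eq]; trivial
  induction hx using Submodule.span_induction with
  | mem x h => obtain ⟨⟨b, a⟩, rfl⟩ := h; exact ht b a
  | zero => simpa using hsmul 0 _ (ht 1 1)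
  | add x y _ _ hx hy => exact hadd x y hx hy
  | smul c x _ hx => exact hsmul c x hx

lemma hom_ext {N : Type*} [AddCommMonoid N] [Module k N] {f g : M.Bicross k →ₗ[k] N}
    (h : ∀ b a, f (t M k b a) = g (t M k b a)) : f = g :=
  (basis M k).ext fun i => h i.1 i.2

variable (M k)

/-- The linear map with prescribed values on the basis elements `δ_b ⊗ a`. -/
noncomputable def lift {N : Type*} [AddCommMonoid N] [Module k N] (f : Y → X → N) :
    M.Bicross k →ₗ[k] N :=
  (basis M k).constr k fun i => f i.1 i.2

variable {M k}

@[simp]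
lemma lift_t {N : Type*} [AddCommMonoid N] [Module k N] (f : Y → X → N) (b : Y) (a : X) :
    lift M k f (t M k b a) = f b a :=
  (basis M k).constr_basis k _ _

/-- The multiplication of the bicrossproduct as a bilinear map. -/
noncomputable def mulHom : M.Bicross k →ₗ[k] M.Bicross k →ₗ[k] M.Bicross k :=
  lift M k fun b a => lift M k fun c d => if b = M.l a c then t M k b (a * d) else 0

noncomputable instance : Mul (M.Bicross k) := ⟨fun x y => mulHom x y⟩

lemma mul_def (x y : M.Bicross k) : x * y = mulHom x y := rfl

lemma t_mul_t (b c : Y) (a d : X) :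
    t M k b a * t M k c d = if b = M.l a c then t M k b (a * d) else 0 := by
  simp [mul_def, mulHom]

noncomputable instance [Fintype Y] : One (M.Bicross k) := ⟨∑ b, t M k b 1⟩

lemma one_def [Fintype Y] : (1 : M.Bicross k) = ∑ b, t M k b 1 := rfl

noncomputable instance : NonUnitalNonAssocRing (M.Bicross k) where
  left_distrib x y z := by simp [mul_def]
  right_distrib x y z := by simp [mul_def]
  zero_mul x := by simp [mul_def]
  mul_zero x := by simp [mul_def]

lemma smul_mul (c : k) (x y : M.Bicross k) : c • x * y = c • (x * y) := by simp [mul_def]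

lemma mul_smul' (c : k) (x y : M.Bicross k) : x * c • y = c • (x * y) := by simp [mul_def]

protected lemma mul_assoc (x y z : M.Bicross k) : x * y * z = x * (y * z) := by
  induction x using induction with
  | hadd x x' h h' => simp only [add_mul, h, h']
  | hsmul c x h => simp only [smul_mul, h]
  | ht b a =>
  induction y using induction with
  | hadd x x' h h' => simp only [add_mul, mul_add, h, h']
  | hsmul c x h => simp only [smul_mul, mul_smul', h]
  | ht c d =>
  induction z using induction with
  | hadd x x' h h' => simp only [mul_add, h, h']
  | hsmul c x h => simp only [mul_smul', h]
  | ht e f =>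
  simp only [t_mul_t, ite_mul, mul_ite, zero_mul, mul_zero, M.mul_l, mul_assoc]
  by_cases h : c = M.l d e
  · split_ifs <;> simp_all
  · have h' : M.l a c ≠ M.l a (M.l d e) := fun h' => h (M.l_injective a h')
    split_ifs <;> simp_all

variable [Fintype Y]

protected lemma one_mul (x : M.Bicross k) : 1 * x = x := by
  induction x using induction with
  | hadd x x' h h' => simp only [mul_add, h, h']
  | hsmul c x h => simp only [mul_smul', h]
  | ht b a => simp [one_def, Finset.sum_mul, t_mul_t, M.one_l]

protected lemma mul_one (x : M.Bicross k) : x * 1 = x := by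
  induction x using induction with
  | hadd x x' h h' => simp only [add_mul, h, h']
  | hsmul c x h => simp only [smul_mul, h]
  | ht b a =>
    have h (c : Y) : b = M.l a c ↔ M.l a⁻¹ b = c :=
      ⟨fun h => h ▸ M.l_inv_l a c, fun h => h ▸ (M.l_l_inv a b).symm⟩
    simp [one_def, Finset.mul_sum, t_mul_t, h]

noncomputable instance : Ring (M.Bicross k) where
  __ := (inferInstance : NonUnitalNonAssocRing (M.Bicross k))
  mul_assoc := Bicross.mul_assoc
  one_mul := Bicross.one_mul
  mul_one := Bicross.mul_one

noncomputable instance : Algebra k (M.Bicross k) := Algebra.ofModule smul_mul mul_smul'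

open TensorProduct

noncomputable instance : CoalgebraStruct k (M.Bicross k) where
  comul := lift M k fun x a => ∑ b, t M k b a ⊗ₜ[k] t M k (b⁻¹ * x) (M.r b⁻¹ a)
  counit := lift M k fun x _ => if x = 1 then 1 else 0

lemma comul_t (x : Y) (a : X) : CoalgebraStruct.comul (R := k) (t M k x a) =
    ∑ b, t M k b a ⊗ₜ[k] t M k (b⁻¹ * x) (M.r b⁻¹ a) := lift_t _ _ _

lemma counit_t (x : Y) (a : X) :
    CoalgebraStruct.counit (R := k) (t M k x a) = if x = 1 then 1 else 0 := lift_t _ _ _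

noncomputable instance : Coalgebra k (M.Bicross k) where
  coassoc := by
    refine hom_ext fun x a => ?_
    simp only [LinearMap.comp_apply, comul_t, map_sum, LinearMap.rTensor_tmul,
      LinearMap.lTensor_tmul, LinearEquiv.coe_coe, sum_tmul, tmul_sum, assoc_tmul]
    rw [Finset.sum_comm]
    refine Finset.sum_congr rfl fun b _ => ?_
    refine Fintype.sum_equiv (Equiv.mulLeft b⁻¹) _ _ fun c => ?_
    simp [← M.mul_r, mul_assoc]
  rTensor_counit_comp_comul := by
    refine hom_ext fun x a => ?_
    simp [comul_t, counit_t, ite_tmul, M.one_r]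
  lTensor_counit_comp_comul := by
    refine hom_ext fun x a => ?_
    simp [comul_t, counit_t, tmul_ite, inv_mul_eq_one]

protected lemma comul_mul (x y : M.Bicross k) : Coalgebra.comul (R := k) (x * y) =
    Coalgebra.comul (R := k) x * Coalgebra.comul (R := k) y := by
  induction x using induction with
  | hadd x x' h h' => simp only [add_mul, map_add, h, h']
  | hsmul c x h => simp only [smul_mul_assoc, map_smul, h]
  | ht x a =>
  induction y using induction with
  | hadd x x' h h' => simp only [mul_add, map_add, h, h']
  | hsmul c x h => simp only [mul_smul_comm, map_smul, h]
  | ht y d =>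
  simp only [t_mul_t, comul_t, Finset.sum_mul_sum, Algebra.TensorProduct.tmul_mul_tmul]
  rw [Finset.sum_comm]
  have h (b' b : Y) : ((if b = M.l a b' then t M k b (a * d) else 0) ⊗ₜ[k]
      (if b⁻¹ * x = M.l (M.r b⁻¹ a) (b'⁻¹ * y) then
        t M k (b⁻¹ * x) (M.r b⁻¹ a * M.r b'⁻¹ d) else 0)) =
      if b = M.l a b' then (if x = M.l a y then
        t M k b (a * d) ⊗ₜ[k] t M k (b⁻¹ * x) (M.r b⁻¹ (a * d)) else 0) else 0 := by
    by_cases hb : b = M.l a b'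
    · subst hb
      have : (M.l a b')⁻¹ * x = M.l (M.r (M.l a b')⁻¹ a) (b'⁻¹ * y) ↔ x = M.l a y := by
        rw [inv_mul_eq_iff_eq_mul, ← M.l_mul, mul_inv_cancel_left]
      simp only [if_true, this, M.r_mul]
      split_ifs <;> simp
    · simp [hb]
  simp only [h, Finset.sum_ite_eq', Finset.mem_univ, if_true]
  split_ifs with hxy
  · rw [comul_t]
    refine (Fintype.sum_equiv (M.lEquiv a) _ _ fun b => rfl).symm
  · simp

noncomputable instance : Bialgebra k (M.Bicross k) :=
  Bialgebra.mk' k (M.Bicross k)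
    (by simp [one_def, map_sum, counit_t])
    (by
      intro x y
      induction x using induction with
      | hadd x x' h h' => simp only [add_mul, map_add, h, h']
      | hsmul c x h => simp only [smul_mul_assoc, map_smul, h]
      | ht x a =>
      induction y using induction with
      | hadd x x' h h' => simp only [mul_add, map_add, h, h']
      | hsmul c x h => simp only [mul_smul_comm, map_smul, h]
      | ht y d =>
      have h : M.l a y = 1 ↔ y = 1 :=
        ⟨fun h => by rw [← M.l_inv_l a y, h, M.l_one], fun h => h ▸ M.l_one a⟩
      rw [t_mul_t, apply_ite (CoalgebraStruct.counit (R := k)), map_zero]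
      simp only [counit_t]
      split_ifs <;> simp_all)
    (by
      simp only [one_def, map_sum, comul_t, M.r_one, Algebra.TensorProduct.one_def, sum_tmul,
        tmul_sum]
      rw [Finset.sum_comm]
      conv_rhs => rw [Finset.sum_comm]
      refine Finset.sum_congr rfl fun b _ => ?_
      exact Fintype.sum_equiv (Equiv.mulLeft b⁻¹) _ _ fun c => rfl)
    (Bicross.comul_mul _ _)

noncomputable instance : HopfAlgebra k (M.Bicross k) where
  antipode := lift M k fun b a => t M k (M.l a⁻¹ b)⁻¹ (M.r b⁻¹ a)⁻¹
  mul_antipode_rTensor_comul := by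
    refine hom_ext fun x a => ?_
    simp only [LinearMap.comp_apply, comul_t, counit_t, map_sum, LinearMap.rTensor_tmul, lift_t,
      LinearMap.mul'_apply, t_mul_t]
    rw [← (M.lEquiv a).sum_comp]
    simp only [lEquiv_apply, M.l_inv_l, M.eq_l_inv_iff, inv_mul_cancel]
    split_ifs
    · rw [Algebra.linearMap_apply, map_one, one_def]
      exact Equiv.sum_comp (Equiv.inv Y) fun c => t M k c 1
    · simp
  mul_antipode_lTensor_comul := by
    refine hom_ext fun x a => ?_
    simp only [LinearMap.comp_apply, comul_t, counit_t, map_sum, LinearMap.lTensor_tmul, lift_t,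
      LinearMap.mul'_apply, t_mul_t, ← M.mul_r]
    rw [← (M.lEquiv a).sum_comp]
    simp only [lEquiv_apply, (M.l_injective a).eq_iff, ← inv_eq_iff_eq_inv, M.eq_l_inv_iff]
    split_ifs with hx
    · subst hx
      rw [Algebra.linearMap_apply, map_one, one_def]
      simp only [mul_one, inv_inv, mul_inv_cancel, M.one_r]
      exact Equiv.sum_comp (M.lEquiv a) fun c => t M k c 1
    · simp

variable [Fintype X]

/-- The average of a linear endomorphism against
`∑ (δ_b ⊗ a) ⊗ (δ_{a⁻¹ ▹ b} ⊗ a⁻¹)`, which is `|X|` times a separability idempotent. -/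
noncomputable def average (f : M.Bicross k →ₗ[k] M.Bicross k) : M.Bicross k →ₗ[k] M.Bicross k :=
  ∑ a : X, ∑ b : Y, LinearMap.mulLeft k (t M k b a) ∘ₗ f ∘ₗ
    LinearMap.mulLeft k (t M k (M.l a⁻¹ b) a⁻¹)

lemma average_apply (f : M.Bicross k →ₗ[k] M.Bicross k) (x : M.Bicross k) :
    average f x = ∑ a : X, ∑ b : Y, t M k b a * f (t M k (M.l a⁻¹ b) a⁻¹ * x) := by
  simp [average]

lemma average_mul (f : M.Bicross k →ₗ[k] M.Bicross k) (y x : M.Bicross k) :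
    average f (y * x) = y * average f x := by
  induction y using induction with
  | hadd x x' h h' => simp only [add_mul, map_add, h, h']
  | hsmul c x h => simp only [smul_mul_assoc, map_smul, h]
  | ht c d =>
  simp only [average_apply, Finset.mul_sum, ← mul_assoc, t_mul_t, (M.l_injective _).eq_iff]
  rw [← Equiv.sum_comp (Equiv.mulLeft d)]
  refine Finset.sum_congr rfl fun a _ => ?_
  have h (b : Y) : c = M.l d b ↔ b = M.l d⁻¹ c :=
    ⟨fun h => h ▸ (M.l_inv_l d b).symm, fun h => h ▸ (M.l_l_inv d c).symm⟩
  simp [h, ite_mul, apply_ite f, M.mul_l]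

lemma average_eq_smul (f : M.Bicross k →ₗ[k] M.Bicross k)
    (N : Submodule (M.Bicross k) (M.Bicross k))
    (hf : ∀ x ∈ N, f x = x) {x : M.Bicross k} (hx : x ∈ N) :
    average f x = (Fintype.card X : k) • x := by
  have h (a : X) (b : Y) : t M k b a * f (t M k (M.l a⁻¹ b) a⁻¹ * x) = t M k b 1 * x := by
    have := hf _ (N.smul_mem (t M k (M.l a⁻¹ b) a⁻¹) hx)
    rw [smul_eq_mul] at this
    rw [this, ← mul_assoc, t_mul_t, M.l_l_inv, if_pos rfl, mul_inv_cancel]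
  simp only [average_apply, h, ← Finset.sum_mul, ← one_def, one_mul, Finset.sum_const,
    Finset.card_univ, Nat.cast_smul_eq_nsmul]

/-- Maschke's theorem for the bicrossproduct. -/
theorem isSemisimpleRing [NeZero (Fintype.card X : k)] : IsSemisimpleRing (M.Bicross k) := by
  rw [IsSemisimpleRing, isSemisimpleModule_iff]
  refine ⟨fun N => ?_⟩
  obtain ⟨p, hp⟩ := (N.restrictScalars k).subtype.exists_leftInverse_of_injective
    (Submodule.ker_subtype _)
  set f := (N.restrictScalars k).subtype ∘ₗ p
  have hfN (x) : f x ∈ N := (p x).2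
  have hf (x) (hx : x ∈ N) : f x = x := congrArg Subtype.val (LinearMap.congr_fun hp ⟨x, hx⟩)
  have hmem (x) : (Fintype.card X : k)⁻¹ • average f x ∈ N := by
    rw [average_apply]
    exact (N.restrictScalars k).smul_mem _
      (N.sum_mem fun a _ => N.sum_mem fun b _ => N.smul_mem _ (hfN _))
  let P : M.Bicross k →ₗ[M.Bicross k] N :=
    { toFun x := ⟨(Fintype.card X : k)⁻¹ • average f x, hmem x⟩
      map_add' x y := by ext1; simp
      map_smul' y x := by ext1; simp [average_mul] }
  refine ⟨_, LinearMap.isCompl_of_proj (f := P) fun x => ?_⟩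
  ext1
  simp [P, average_eq_smul f N hf x.2, smul_smul, NeZero.ne]

variable (M k)

/-- The identification of the bicrossproduct with the tensor product of functions on `Y` and the
group algebra of `X`. -/
noncomputable def equivTensor : M.Bicross k ≃ₗ[k] (Y → k) ⊗[k] MonoidAlgebra k X :=
  (basis M k).equiv ((Pi.basisFun k Y).tensorProduct (MonoidAlgebra.basis X k)) (Equiv.refl _)

variable {M k}

omit [Fintype X] in
lemma equivTensor_t [DecidableEq Y] (b : Y) (a : X) : equivTensor M k (t M k b a) =
    (fun y => if y = b then (1 : k) else 0) ⊗ₜ[k] MonoidAlgebra.of k X a := by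
  have h : Pi.single b (1 : k) = fun y => if y = b then (1 : k) else 0 :=
    funext fun y => Pi.single_apply b 1 y
  simp [equivTensor, t, Module.Basis.tensorProduct_apply, h]

omit [Fintype X] in
lemma equivTensor_symm_tmul [DecidableEq Y] (b : Y) (a : X) : (equivTensor M k).symm
    ((fun y => if y = b then (1 : k) else 0) ⊗ₜ[k] MonoidAlgebra.of k X a) = t M k b a := by
  rw [← equivTensor_t, LinearEquiv.symm_apply_apply]

end Bicross

/-- The matched pair associated with an exact factorization of a group. -/
def ofSubgroups {G : Type*} [Group G] (G1 G2 : Subgroup G) (hinter : G1 ⊓ G2 = ⊥)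
    (actL : G1 → G2 → G2)
    (hactL : ∀ (a : G1) (b : G2),
      (QuotientGroup.mk ((a : G) * (b : G)) : G ⧸ G1) = QuotientGroup.mk ((actL a b : G)))
    (actR : G2 → G1 → G1)
    (hactR : ∀ (b : G2) (a : G1),
      (QuotientGroup.mk ((b : G) * (a : G)) : G ⧸ G2) = QuotientGroup.mk ((actR b a : G))) :
    MatchedPair G1 G2 :=
  have eq_one {g : G} (h1 : g ∈ G1) (h2 : g ∈ G2) : g = 1 :=
    Subgroup.mem_bot.mp (hinter ▸ ⟨h1, h2⟩)
  have l_eq {a : G1} {b p : G2} {x : G1} (h : (a * b : G) = p * x) : actL a b = p := by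
    have h1 := QuotientGroup.eq.mp (hactL a b)
    rw [h, mul_inv_rev, mul_assoc, G1.mul_mem_cancel_left (G1.inv_mem x.2)] at h1
    exact Subtype.ext (inv_mul_eq_one.mp (eq_one h1 (p⁻¹ * actL a b).2)).symm
  have r_eq {b : G2} {a q : G1} {y : G2} (h : (b * a : G) = q * y) : actR b a = q := by
    have h1 := QuotientGroup.eq.mp (hactR b a)
    rw [h, mul_inv_rev, mul_assoc, G2.mul_mem_cancel_left (G2.inv_mem y.2)] at h1
    exact Subtype.ext (inv_mul_eq_one.mp (eq_one (q⁻¹ * actR b a).2 h1)).symm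
  have l_spec (a : G1) (b : G2) : (a * b : G) = actL a b * actR (actL a b)⁻¹ a := by
    have h1 : (a * b : G)⁻¹ * actL a b ∈ G1 := QuotientGroup.eq.mp (hactL a b)
    have h2 : actR (actL a b)⁻¹ a = ⟨_, h1⟩⁻¹ := r_eq (y := b⁻¹) (by simp [mul_assoc])
    simp [h2]
  have r_spec (b : G2) (a : G1) : ∃ y : G2, (b * a : G) = actR b a * y :=
    ⟨⟨_, QuotientGroup.eq.mp (hactR b a)⟩⁻¹, by simp⟩
  { l := actL
    r := actR
    one_l b := l_eq (x := 1) (by simp)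
    mul_l a d b := l_eq (x := actR (actL a (actL d b))⁻¹ a * actR (actL d b)⁻¹ d) <| by
      rw [Subgroup.coe_mul, mul_assoc, l_spec d b, ← mul_assoc, l_spec a, Subgroup.coe_mul,
        mul_assoc]
    one_r a := r_eq (y := 1) (by simp)
    mul_r b c a := by
      obtain ⟨y, hy⟩ := r_spec c a
      obtain ⟨z, hz⟩ := r_spec b (actR c a)
      refine r_eq (y := z * y) ?_
      rw [Subgroup.coe_mul, mul_assoc, hy, ← mul_assoc, hz, Subgroup.coe_mul, mul_assoc]
    l_mul a b c := by
      refine l_eq (x := actR (actL (actR (actL a b)⁻¹ a) c)⁻¹ (actR (actL a b)⁻¹ a)) ?_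
      rw [Subgroup.coe_mul, ← mul_assoc, l_spec a b, mul_assoc, l_spec _ c, Subgroup.coe_mul,
        mul_assoc]
    r_mul a d b := by
      obtain ⟨y, hy⟩ := r_spec b⁻¹ d
      refine r_eq (y := y) ?_
      rw [Subgroup.coe_mul _ (actR _ _), mul_assoc, ← hy, Subgroup.coe_mul, Subgroup.coe_inv,
        inv_mul_eq_iff_eq_mul, ← mul_assoc, ← mul_assoc, ← l_spec]
      simp }

end MatchedPair

/-- Kac–Takeuchi: an exact factorization `G = G1 G2` of a finite group gives rise to a
semisimple bicrossproduct Hopf algebra on `(G2 → ℂ) ⊗ ℂ[G1]`. -/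
theorem bicrossproduct_hopfAlgebra {G : Type} [Group G] [Fintype G]
    (G1 G2 : Subgroup G)
    (hinter : G1 ⊓ G2 = ⊥)
    (hfact : ∀ g : G, ∃ g1 ∈ G1, ∃ g2 ∈ G2, g = g1 * g2)
    -- `actL a b` is the unique element `a ▹ b ∈ G2` with `(a b) G1 = (a ▹ b) G1`
    (actL : G1 → G2 → G2)
    (hactL : ∀ (a : G1) (b : G2),
      (QuotientGroup.mk ((a : G) * (b : G)) : G ⧸ G1) = QuotientGroup.mk ((actL a b : G)))
    -- `actR b a` is the unique element `b ▹ a ∈ G1` with `(b a) G2 = (b ▹ a) G2`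
    (actR : G2 → G1 → G1)
    (hactR : ∀ (b : G2) (a : G1),
      (QuotientGroup.mk ((b : G) * (a : G)) : G ⧸ G2) = QuotientGroup.mk ((actR b a : G))) :
    Nonempty (BicrossproductHopfStructure G1 G2 actL actR) := by
  let M := MatchedPair.ofSubgroups G1 G2 hinter actL hactL actR hactR
  exact ⟨{
    A := M.Bicross ℂ
    equiv := MatchedPair.Bicross.equivTensor M ℂ
    mul_eq := fun a d b c => by
      rw [MatchedPair.Bicross.equivTensor_symm_tmul, MatchedPair.Bicross.equivTensor_symm_tmul,
        MatchedPair.Bicross.t_mul_t, apply_ite (MatchedPair.Bicross.equivTensor M ℂ), map_zero,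
        MatchedPair.Bicross.equivTensor_t]
      by_cases h : b = M.l a c
      · exact (if_pos h).trans (if_pos h).symm
      · exact (if_neg h).trans (if_neg h).symm
    comul_eq := fun x a => by
      rw [MatchedPair.Bicross.equivTensor_symm_tmul, MatchedPair.Bicross.comul_t, map_sum]
      refine Finset.sum_congr rfl fun b _ => ?_
      simp only [← eq_inv_mul_iff_mul_eq, Finset.sum_ite_eq', Finset.mem_univ, if_true,
        TensorProduct.map_tmul, LinearEquiv.coe_coe, MatchedPair.Bicross.equivTensor_t]
      rfl
    semisimple := MatchedPair.Bicross.isSemisimpleRing }⟩
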